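/- The fourth moment of the Chernoff density satisfies ∫_ℝ x⁴ f(x) dx = (7/15)·(1/(2πi)) ∫_{−i∞}^{i∞} z²/Ai(z)² dz, i.e. it equals (7/15)·(1/(2π)) ∫_ℝ (iy)²/Ai(iy)² dy. -/

import Mathlib

/-- Comparison principle: a derivative inequality on `[0, ∞)` integrates. -/
theorem le_of_hasDerivAt_le {f g f' g' : ℝ → ℝ} (hf : ∀ t, HasDerivAt f (f' t) t)
    (hg : ∀ t, HasDerivAt g (g' t) t) (h0 : f 0 ≤ g 0) (h : ∀ t, 0 ≤ t → f' t ≤ g' t)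
    {t : ℝ} (ht : 0 ≤ t) : f t ≤ g t := by
  have hd : ∀ t, HasDerivAt (fun s ↦ g s - f s) (g' t - f' t) t := fun t ↦ (hg t).sub (hf t)
  have hm : MonotoneOn (fun s ↦ g s - f s) (Set.Ici 0) := by
    apply monotoneOn_of_deriv_nonneg (convex_Ici 0)
    · exact fun t _ ↦ (hd t).continuousAt.continuousWithinAt
    · exact fun t _ ↦ (hd t).differentiableAt.differentiableWithinAt
    · intro t ht
      rw [interior_Ici] at ht
      rw [(hd t).deriv]
      linarith [h t (le_of_lt ht)]
  have := hm Set.self_mem_Ici (Set.mem_Ici.2 ht) ht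
  simp only at this
  linarith

theorem hasDerivAt_const_mul_pow (c : ℝ) (n : ℕ) (t : ℝ) :
    HasDerivAt (fun s : ℝ ↦ c / (n + 1) * s ^ (n + 1)) (c * t ^ n) t := by
  refine ((hasDerivAt_pow (n + 1) t).const_mul (c / (n + 1))).congr_deriv ?_
  push_cast
  field_simp

/-- For `w = |u|²` where `u'' = -i t u`: here `P = Re (u' ū)`, `Q = -Im (u' ū)` and `D = |u'|²`. -/
theorem exists_pow_le_of_energy_system {w P Q D : ℝ → ℝ}
    (hw : ∀ t, HasDerivAt w (2 * P t) t) (hP : ∀ t, HasDerivAt P (D t) t)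
    (hQ : ∀ t, HasDerivAt Q (t * w t) t) (hD : ∀ t, w t * D t = P t ^ 2 + Q t ^ 2)
    (hP0 : P 0 = 0) (hQ0 : 0 ≤ Q 0) (hw0 : 0 < w 0) (hw_le : ∀ t, 0 ≤ t → w 0 ≤ w t) (n : ℕ) :
    ∃ c > 0, ∀ t, 0 ≤ t → c * t ^ (3 * n) ≤ w t := by
  induction n with
  | zero => exact ⟨w 0, hw0, fun t ht ↦ by simpa using hw_le t ht⟩
  | succ n ih =>
    obtain ⟨c, hc, h⟩ := ih
    set k := 3 * n with hk
    have h1 : ∀ t, 0 ≤ t → c / ((k + 1 : ℕ) + 1) * t ^ (k + 1 + 1) ≤ Q t := fun t ht ↦ by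
      refine le_of_hasDerivAt_le (hasDerivAt_const_mul_pow c (k + 1)) hQ (by simpa using hQ0) ?_ ht
      intro s hs
      have := mul_le_mul_of_nonneg_left (h s hs) hs
      rw [pow_succ]
      linarith
    set d := c / ((k + 1 : ℕ) + 1) with hd
    have hd0 : 0 < d := by positivity
    have hwP : ∀ t, HasDerivAt (fun s ↦ w s * P s) (3 * P t ^ 2 + Q t ^ 2) t := fun t ↦
      ((hw t).mul (hP t)).congr_deriv (by rw [hD t]; ring)
    have h2 : ∀ t, 0 ≤ t →
        d ^ 2 / ((2 * k + 4 : ℕ) + 1) * t ^ (2 * k + 4 + 1) ≤ w t * P t := fun t ht ↦ by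
      refine le_of_hasDerivAt_le (hasDerivAt_const_mul_pow (d ^ 2) (2 * k + 4)) hwP
        (by simp [hP0]) ?_ ht
      intro s hs
      have := pow_le_pow_left₀ (by positivity) (h1 s hs) 2
      have e : (d * s ^ (k + 1 + 1)) ^ 2 = d ^ 2 * s ^ (2 * k + 4) := by ring
      rw [e] at this
      nlinarith [sq_nonneg (P s)]
    set e := d ^ 2 / ((2 * k + 4 : ℕ) + 1) with he
    have he0 : 0 < e := by positivity
    have hww : ∀ t, HasDerivAt (fun s ↦ w s ^ 2) (4 * (w t * P t)) t := fun t ↦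
      ((hw t).pow 2).congr_deriv (by push_cast; ring)
    have h3 : ∀ t, 0 ≤ t →
        e / ((2 * k + 5 : ℕ) + 1) * t ^ (2 * k + 5 + 1) ≤ w t ^ 2 := fun t ht ↦ by
      refine le_of_hasDerivAt_le (hasDerivAt_const_mul_pow e (2 * k + 5)) hww
        (by simp; positivity) ?_ ht
      intro s hs
      have := h2 s hs
      have : 0 ≤ e * s ^ (2 * k + 5) := by positivity
      linarith
    refine ⟨√(e / ((2 * k + 5 : ℕ) + 1)), by positivity, fun t ht ↦ ?_⟩
    refine le_of_sq_le_sq ?_ (hw0.le.trans (hw_le t ht))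
    rw [mul_pow, Real.sq_sqrt (by positivity), ← pow_mul,
      show 3 * (n + 1) * 2 = 2 * k + 5 + 1 by omega]
    exact h3 t ht

open Complex ComplexConjugate MeasureTheory
open scoped SchwartzMap FourierTransform

section HalfLine

variable {u v : ℝ → ℂ}

/-- Growth on the half line of solutions of `u'' = -i t u` with suitable initial data. -/
theorem norm_growth_of_hasDerivAt (hu : ∀ t, HasDerivAt u (v t) t)
    (hv : ∀ t : ℝ, HasDerivAt v (-(I * t * u t)) t) (h0 : u 0 ≠ 0)
    (hre : (v 0 * conj (u 0)).re = 0) (him : (v 0 * conj (u 0)).im ≤ 0) :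
    (∀ s t, 0 ≤ s → s ≤ t → ‖u s‖ ≤ ‖u t‖) ∧
      ∀ n : ℕ, ∃ c > 0, ∀ t, 0 ≤ t → c * t ^ (3 * n) ≤ ‖u t‖ ^ 2 := by
  have ha : ∀ t, HasDerivAt (fun s ↦ (u s).re) (v t).re t := fun t ↦
    (reCLM.hasFDerivAt.comp_hasDerivAt t (hu t))
  have hb : ∀ t, HasDerivAt (fun s ↦ (u s).im) (v t).im t := fun t ↦
    (imCLM.hasFDerivAt.comp_hasDerivAt t (hu t))
  have hp : ∀ t, HasDerivAt (fun s ↦ (v s).re) (t * (u t).im) t := fun t ↦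
    (reCLM.hasFDerivAt.comp_hasDerivAt t (hv t)).congr_deriv (by simp)
  have hq : ∀ t, HasDerivAt (fun s ↦ (v s).im) (-(t * (u t).re)) t := fun t ↦
    (imCLM.hasFDerivAt.comp_hasDerivAt t (hv t)).congr_deriv (by simp)
  have hn : ∀ t, ‖u t‖ ^ 2 = (u t).re * (u t).re + (u t).im * (u t).im := fun t ↦ by
    rw [← normSq_eq_norm_sq, normSq_apply]
  have hw : ∀ t, HasDerivAt (fun s ↦ ‖u s‖ ^ 2)
      (2 * ((v t).re * (u t).re + (v t).im * (u t).im)) t := fun t ↦ by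
    simp only [hn]
    exact (((ha t).mul (ha t)).add ((hb t).mul (hb t))).congr_deriv (by ring)
  have hP : ∀ t, HasDerivAt (fun s ↦ (v s).re * (u s).re + (v s).im * (u s).im)
      ((v t).re ^ 2 + (v t).im ^ 2) t := fun t ↦
    (((hp t).mul (ha t)).add ((hq t).mul (hb t))).congr_deriv (by ring)
  have hQ : ∀ t, HasDerivAt (fun s ↦ (v s).re * (u s).im - (v s).im * (u s).re)
      (t * ‖u t‖ ^ 2) t := fun t ↦
    (((hp t).mul (hb t)).sub ((hq t).mul (ha t))).congr_deriv (by rw [hn]; ring)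
  have hP0 : (v 0).re * (u 0).re + (v 0).im * (u 0).im = 0 := by simpa using hre
  have hQ0 : 0 ≤ (v 0).re * (u 0).im - (v 0).im * (u 0).re := by simp at him; linarith
  have hPn : ∀ t, 0 ≤ t → 0 ≤ (v t).re * (u t).re + (v t).im * (u t).im := fun t ht ↦
    le_of_hasDerivAt_le (fun t ↦ hasDerivAt_const t (0 : ℝ)) hP hP0.ge (fun t _ ↦ by positivity) ht
  have hmono : MonotoneOn (fun s ↦ ‖u s‖ ^ 2) (Set.Ici 0) := by
    apply monotoneOn_of_deriv_nonneg (convex_Ici 0)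
    · exact fun t _ ↦ (hw t).continuousAt.continuousWithinAt
    · exact fun t _ ↦ (hw t).differentiableAt.differentiableWithinAt
    · intro t ht
      rw [interior_Ici] at ht
      rw [(hw t).deriv]
      linarith [hPn t (le_of_lt ht)]
  refine ⟨fun s t hs hst ↦ ?_, fun n ↦ ?_⟩
  · exact le_of_sq_le_sq (hmono (Set.mem_Ici.2 hs) (Set.mem_Ici.2 (hs.trans hst)) hst)
      (norm_nonneg _)
  · exact exists_pow_le_of_energy_system hw hP hQ (fun t ↦ by rw [hn]; ring) hP0 hQ0
      (by positivity) (fun t ht ↦ hmono Set.self_mem_Ici (Set.mem_Ici.2 ht) ht) n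

theorem norm_deriv_le_of_hasDerivAt (hv : ∀ t : ℝ, HasDerivAt v (-(I * t * u t)) t)
    (hmono : ∀ s t, 0 ≤ s → s ≤ t → ‖u s‖ ≤ ‖u t‖) {t : ℝ} (ht : 0 ≤ t) :
    ‖v t‖ ≤ ‖v 0‖ + t ^ 2 * ‖u t‖ := by
  have := (convex_Icc 0 t).norm_image_sub_le_of_norm_hasDerivWithin_le (f := v) (C := t * ‖u t‖)
    (fun s _ ↦ (hv s).hasDerivWithinAt) (fun s hs ↦ by
      rw [norm_neg, norm_mul, norm_mul, norm_I, one_mul, norm_real, Real.norm_of_nonneg hs.1]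
      exact mul_le_mul hs.2 (hmono s t hs.1 hs.2) (norm_nonneg _) ht)
    (Set.left_mem_Icc.2 ht) (Set.right_mem_Icc.2 ht)
  rw [sub_zero, Real.norm_of_nonneg ht] at this
  have h2 := norm_add_le (v 0) (v t - v 0)
  rw [add_sub_cancel] at h2
  nlinarith

end HalfLine

/-- A function on the line decaying faster than any power. -/
def RapidDecay (F : ℝ → ℂ) : Prop := ∀ k : ℕ, ∃ C : ℝ, ∀ t : ℝ, |t| ^ k * ‖F t‖ ≤ C

namespace RapidDecay

variable {F G : ℝ → ℂ}

theorem add (hF : RapidDecay F) (hG : RapidDecay G) : RapidDecay (F + G) := fun k ↦ by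
  obtain ⟨C, hC⟩ := hF k
  obtain ⟨D, hD⟩ := hG k
  refine ⟨C + D, fun t ↦ ?_⟩
  calc |t| ^ k * ‖F t + G t‖ ≤ |t| ^ k * (‖F t‖ + ‖G t‖) := by gcongr; exact norm_add_le _ _
    _ ≤ C + D := by linarith [hC t, hD t]

/-- Multiplication by a function of at most quadratic growth preserves rapid decay. -/
theorem mul_left (hF : RapidDecay F) {M : ℝ} (hG : ∀ t, ‖G t‖ ≤ M * (1 + t ^ 2)) :
    RapidDecay (fun t ↦ G t * F t) := fun k ↦ by
  obtain ⟨C, hC⟩ := hF k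
  obtain ⟨D, hD⟩ := hF (k + 2)
  refine ⟨M * (C + D), fun t ↦ ?_⟩
  have hM : 0 ≤ M := by have := (norm_nonneg _).trans (hG 0); simpa using this
  rw [norm_mul]
  calc |t| ^ k * (‖G t‖ * ‖F t‖) ≤ |t| ^ k * ((M * (1 + t ^ 2)) * ‖F t‖) := by gcongr; exact hG t
    _ = M * (|t| ^ k * ‖F t‖ + |t| ^ (k + 2) * ‖F t‖) := by rw [← sq_abs t]; ring
    _ ≤ M * (C + D) := by gcongr; exacts [hC t, hD t]

theorem integrable (hF : RapidDecay F) (hc : Continuous F) : MeasureTheory.Integrable F := by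
  obtain ⟨C, hC⟩ := hF 0
  obtain ⟨D, hD⟩ := hF 2
  refine (integrable_inv_one_add_sq.const_mul (C + D)).mono' hc.aestronglyMeasurable
    (.of_forall fun t ↦ ?_)
  rw [← div_eq_mul_inv, le_div_iff₀ (by positivity)]
  have h1 := hC t
  have h2 := hD t
  rw [sq_abs] at h2
  linarith

end RapidDecay

section Line

variable {u v : ℝ → ℂ}

theorem reflection_hasDerivAt (hu : ∀ t, HasDerivAt u (v t) t)
    (hv : ∀ t : ℝ, HasDerivAt v (-(I * t * u t)) t) :
    (∀ t, HasDerivAt (fun s ↦ conj (u (-s))) (-conj (v (-t))) t) ∧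
      ∀ t : ℝ, HasDerivAt (fun s ↦ -conj (v (-s))) (-(I * t * conj (u (-t)))) t := by
  constructor
  · intro t
    have h := (hu (-t)).scomp t (hasDerivAt_neg t)
    exact (conjCLE.toContinuousLinearMap.hasFDerivAt.comp_hasDerivAt t h).congr_deriv (by simp)
  · intro t
    have h := (hv (-t)).scomp t (hasDerivAt_neg t)
    exact (conjCLE.toContinuousLinearMap.hasFDerivAt.comp_hasDerivAt t h).neg.congr_deriv (by simp)

theorem exists_pow_mul_inv_le (h0 : u 0 ≠ 0)
    (hmono : ∀ s t, 0 ≤ s → s ≤ t → ‖u s‖ ≤ ‖u t‖)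
    (hgrow : ∀ n : ℕ, ∃ c > 0, ∀ t, 0 ≤ t → c * t ^ (3 * n) ≤ ‖u t‖ ^ 2) (k : ℕ) :
    ∃ C, 0 ≤ C ∧ ∀ t, 0 ≤ t → t ^ k * ‖(u t)⁻¹‖ ≤ C := by
  obtain ⟨c, hc, h⟩ := hgrow (2 * k)
  refine ⟨‖u 0‖⁻¹ + (√c)⁻¹, by positivity, fun t ht ↦ ?_⟩
  have hpos : 0 < ‖u 0‖ := norm_pos_iff.2 h0
  have hm := hmono 0 t le_rfl ht
  have hut : 0 < ‖u t‖ := hpos.trans_le hm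
  rw [norm_inv, ← div_eq_mul_inv, div_le_iff₀ hut]
  have h1 : 1 ≤ ‖u 0‖⁻¹ * ‖u t‖ := by rw [inv_mul_eq_div, one_le_div hpos]; exact hm
  have h2 : t ^ (3 * k) ≤ (√c)⁻¹ * ‖u t‖ := by
    rw [inv_mul_eq_div, le_div_iff₀ (by positivity)]
    refine le_of_sq_le_sq ?_ hut.le
    rw [mul_pow, Real.sq_sqrt hc.le, ← pow_mul, mul_comm, show 3 * k * 2 = 3 * (2 * k) by ring]
    exact h t ht
  have h3 : t ^ k ≤ 1 + t ^ (3 * k) := by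
    rcases le_total t 1 with h | h
    · have := pow_le_one₀ (n := k) ht h
      have : 0 ≤ t ^ (3 * k) := by positivity
      linarith
    · have := pow_le_pow_right₀ h (show k ≤ 3 * k by omega)
      linarith
  linarith [add_mul (‖u 0‖⁻¹) (√c)⁻¹ ‖u t‖]

/-- On the whole line: `u` has no zero, `1 / u` decays rapidly and `u' / u` grows at most
quadratically. -/
theorem inv_rapidDecay_of_hasDerivAt (hu : ∀ t, HasDerivAt u (v t) t)
    (hv : ∀ t : ℝ, HasDerivAt v (-(I * t * u t)) t) (h0 : u 0 ≠ 0)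
    (hre : (v 0 * conj (u 0)).re = 0) (him : (v 0 * conj (u 0)).im ≤ 0) :
    (∀ t, u t ≠ 0) ∧ RapidDecay (fun t ↦ (u t)⁻¹) ∧
      ∃ M, ∀ t : ℝ, ‖v t / u t‖ ≤ M * (1 + t ^ 2) := by
  obtain ⟨hm, hg⟩ := norm_growth_of_hasDerivAt hu hv h0 hre him
  obtain ⟨hu', hv'⟩ := reflection_hasDerivAt hu hv
  have h0' : conj (u (-0)) ≠ 0 := by simpa using h0
  obtain ⟨hm', hg'⟩ := norm_growth_of_hasDerivAt hu' hv' h0'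
    (by simp at hre ⊢; linarith) (by simp at him ⊢; linarith)
  have hle : ∀ t, ‖u 0‖ ≤ ‖u t‖ := fun t ↦ by
    rcases le_total 0 t with ht | ht
    · exact hm 0 t le_rfl ht
    · simpa using hm' 0 (-t) le_rfl (by linarith)
  have hpos : 0 < ‖u 0‖ := norm_pos_iff.2 h0
  have hd : ∀ t, ‖v t‖ ≤ ‖v 0‖ + t ^ 2 * ‖u t‖ := fun t ↦ by
    rcases le_total 0 t with ht | ht
    · exact norm_deriv_le_of_hasDerivAt hv hm ht
    · simpa using norm_deriv_le_of_hasDerivAt hv' hm' (t := -t) (by linarith)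
  refine ⟨fun t ↦ norm_pos_iff.1 (hpos.trans_le (hle t)), fun k ↦ ?_, ‖v 0‖ / ‖u 0‖ + 1, fun t ↦ ?_⟩
  · obtain ⟨C, hC0, hC⟩ := exists_pow_mul_inv_le h0 hm hg k
    obtain ⟨D, hD0, hD⟩ := exists_pow_mul_inv_le h0' hm' hg' k
    refine ⟨C + D, fun t ↦ ?_⟩
    rcases le_total 0 t with ht | ht
    · rw [abs_of_nonneg ht]; linarith [hC t ht]
    · rw [abs_of_nonpos ht]
      have := hD (-t) (by linarith)
      simp only [neg_neg, norm_inv, RCLike.norm_conj] at this ⊢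
      linarith
  · have hut := hpos.trans_le (hle t)
    rw [norm_div, div_le_iff₀ hut]
    have h1 : ‖v 0‖ ≤ ‖v 0‖ / ‖u 0‖ * ‖u t‖ := by
      rw [div_mul_eq_mul_div, le_div_iff₀ hpos]
      gcongr
      exact hle t
    have h2 : 0 ≤ t ^ 2 * (‖v 0‖ / ‖u 0‖ * ‖u t‖) := by positivity
    nlinarith [hd t]

end Line

section LogDeriv

/-- Linear span of the functions `t ^ m * q ^ j * φ`. -/
def monomialSpan (q φ : ℝ → ℂ) : Submodule ℂ (ℝ → ℂ) :=
  Submodule.span ℂ {F | ∃ m j : ℕ, F = fun t : ℝ ↦ (t : ℂ) ^ m * q t ^ j * φ t}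

variable {q φ : ℝ → ℂ}

theorem rapidDecay_monomial (hφ : RapidDecay φ) {M : ℝ} (hq : ∀ t : ℝ, ‖q t‖ ≤ M * (1 + t ^ 2))
    (m j : ℕ) : RapidDecay (fun t : ℝ ↦ (t : ℂ) ^ m * q t ^ j * φ t) := by
  have hj : RapidDecay (fun t ↦ q t ^ j * φ t) := by
    induction j with
    | zero => simpa using hφ
    | succ j ih => simpa only [pow_succ', mul_assoc] using ih.mul_left hq
  induction m with
  | zero => simpa using hj
  | succ m ih =>
    have ht : ∀ t : ℝ, ‖(t : ℂ)‖ ≤ 1 * (1 + t ^ 2) := fun t ↦ by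
      rw [norm_real, Real.norm_eq_abs]
      nlinarith [sq_abs t, sq_nonneg (|t| - 1)]
    simpa only [pow_succ', mul_assoc] using ih.mul_left ht

theorem monomial_mem (q φ : ℝ → ℂ) (m j : ℕ) :
    (fun t : ℝ ↦ (t : ℂ) ^ m * q t ^ j * φ t) ∈ monomialSpan q φ :=
  Submodule.subset_span ⟨m, j, rfl⟩

theorem rapidDecay_of_mem (hφ : RapidDecay φ) {M : ℝ} (hq : ∀ t : ℝ, ‖q t‖ ≤ M * (1 + t ^ 2))
    {F : ℝ → ℂ} (hF : F ∈ monomialSpan q φ) : RapidDecay F := by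
  induction hF using Submodule.span_induction with
  | mem F h => obtain ⟨m, j, rfl⟩ := h; exact rapidDecay_monomial hφ hq m j
  | zero => exact fun k ↦ ⟨0, by simp⟩
  | add F G _ _ h1 h2 => exact h1.add h2
  | smul a F _ h =>
    refine h.mul_left (G := fun _ ↦ a) (M := ‖a‖) fun t ↦ ?_
    nlinarith [norm_nonneg a, sq_nonneg t, mul_nonneg (norm_nonneg a) (sq_nonneg t)]

theorem hasDerivAt_monomial (hφ : ∀ t, HasDerivAt φ (-(q t * φ t)) t)
    (hq : ∀ t : ℝ, HasDerivAt q (-(I * t) - q t ^ 2) t) (m j : ℕ) (t : ℝ) :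
    HasDerivAt (fun t : ℝ ↦ (t : ℂ) ^ m * q t ^ j * φ t)
      (m * ((t : ℂ) ^ (m - 1) * q t ^ j * φ t) - I * j * ((t : ℂ) ^ (m + 1) * q t ^ (j - 1) * φ t)
        - (j + 1) * ((t : ℂ) ^ m * q t ^ (j + 1) * φ t)) t := by
  have ht : HasDerivAt (fun t : ℝ ↦ (t : ℂ)) 1 t := ofRealCLM.hasDerivAt
  refine (((ht.pow m).mul ((hq t).pow j)).mul (hφ t)).congr_deriv ?_
  rcases j with _ | j
  · simp; ring
  · simp; ring

theorem differentiable_and_deriv_mem (hφ : ∀ t, HasDerivAt φ (-(q t * φ t)) t)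
    (hq : ∀ t : ℝ, HasDerivAt q (-(I * t) - q t ^ 2) t) {F : ℝ → ℂ} (hF : F ∈ monomialSpan q φ) :
    Differentiable ℝ F ∧ deriv F ∈ monomialSpan q φ := by
  induction hF using Submodule.span_induction with
  | mem F h =>
    obtain ⟨m, j, rfl⟩ := h
    have h := hasDerivAt_monomial hφ hq m j
    refine ⟨fun t ↦ (h t).differentiableAt, ?_⟩
    rw [funext fun t ↦ (h t).deriv]
    exact Submodule.sub_mem _ (Submodule.sub_mem _
      (Submodule.smul_mem _ (m : ℂ) (monomial_mem q φ (m - 1) j))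
      (Submodule.smul_mem _ (I * j) (monomial_mem q φ (m + 1) (j - 1))))
      (Submodule.smul_mem _ (j + 1 : ℂ) (monomial_mem q φ m (j + 1)))
  | zero => exact ⟨differentiable_const 0, by simp [deriv_zero]⟩
  | add F G _ _ h1 h2 =>
    refine ⟨h1.1.add h2.1, ?_⟩
    rw [show deriv (F + G) = deriv F + deriv G from
      funext fun t ↦ deriv_add (h1.1 t) (h2.1 t)]
    exact Submodule.add_mem _ h1.2 h2.2
  | smul a F _ h =>
    refine ⟨h.1.const_smul a, ?_⟩
    rw [show deriv (a • F) = a • deriv F from funext fun t ↦ deriv_const_smul a (h.1 t)]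
    exact Submodule.smul_mem _ a h.2

theorem exists_schwartz (hφ : ∀ t, HasDerivAt φ (-(q t * φ t)) t)
    (hq : ∀ t : ℝ, HasDerivAt q (-(I * t) - q t ^ 2) t) (hφd : RapidDecay φ) {M : ℝ}
    (hqM : ∀ t : ℝ, ‖q t‖ ≤ M * (1 + t ^ 2)) : ∃ H : 𝓢(ℝ, ℂ), ∀ t, H t = φ t := by
  have hmem : ∀ n : ℕ, iteratedDeriv n φ ∈ monomialSpan q φ := by
    intro n
    induction n with
    | zero => simpa using monomial_mem q φ 0 0
    | succ n ih =>
      rw [iteratedDeriv_succ]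
      exact (differentiable_and_deriv_mem hφ hq ih).2
  refine ⟨⟨φ, contDiff_of_differentiable_iteratedDeriv fun m _ ↦
    (differentiable_and_deriv_mem hφ hq (hmem m)).1, fun k n ↦ ?_⟩, fun t ↦ rfl⟩
  obtain ⟨C, hC⟩ := rapidDecay_of_mem hφd hqM (hmem n) k
  exact ⟨C, fun t ↦ by
    rw [norm_iteratedFDeriv_eq_norm_iteratedDeriv, Real.norm_eq_abs]
    exact hC t⟩

theorem integrable_monomial_mul (hφ : ∀ t, HasDerivAt φ (-(q t * φ t)) t)
    (hq : ∀ t : ℝ, HasDerivAt q (-(I * t) - q t ^ 2) t) (hφd : RapidDecay φ) {M : ℝ}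
    (hqM : ∀ t : ℝ, ‖q t‖ ≤ M * (1 + t ^ 2)) (m j : ℕ) :
    Integrable (fun t : ℝ ↦ (t : ℂ) ^ m * q t ^ j * φ t ^ 2) := by
  obtain ⟨C, hC⟩ := hφd 0
  have hC' : ∀ t : ℝ, ‖φ t‖ ≤ C * (1 + t ^ 2) := fun t ↦ by
    have h := hC t
    rw [pow_zero, one_mul] at h
    nlinarith [mul_nonneg ((norm_nonneg _).trans h) (sq_nonneg t)]
  have hr := (rapidDecay_monomial hφd hqM m j).mul_left hC'
  have hφc : Continuous φ := continuous_iff_continuousAt.2 fun t ↦ (hφ t).continuousAt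
  have hqc : Continuous q := continuous_iff_continuousAt.2 fun t ↦ (hq t).continuousAt
  refine (hr.integrable (by fun_prop)).congr (.of_forall fun t ↦ ?_)
  simp only
  ring

/-- The integral of `(φ'')²` in terms of that of `t² φ²`, where `φ'' = (i t + 2 q²) φ`. -/
theorem integral_sq_deriv_deriv (hφ : ∀ t, HasDerivAt φ (-(q t * φ t)) t)
    (hq : ∀ t : ℝ, HasDerivAt q (-(I * t) - q t ^ 2) t) (hφd : RapidDecay φ) {M : ℝ}
    (hqM : ∀ t : ℝ, ‖q t‖ ≤ M * (1 + t ^ 2)) :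
    ∫ t : ℝ, ((I * t + 2 * q t ^ 2) * φ t) ^ 2 = -(7 / 15) * ∫ t : ℝ, (t : ℂ) ^ 2 * φ t ^ 2 := by
  have hi := integrable_monomial_mul hφ hq hφd hqM
  have hd : ∀ t : ℝ, HasDerivAt (fun t : ℝ ↦ -(4 / 5) * (q t ^ 3 * φ t ^ 2)
      - (8 / 15) * I * (t * q t * φ t ^ 2) - (4 / 15) * I * φ t ^ 2)
      (((I * t + 2 * q t ^ 2) * φ t) ^ 2 + 7 / 15 * ((t : ℂ) ^ 2 * φ t ^ 2)) t := fun t ↦ by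
    have ht : HasDerivAt (fun t : ℝ ↦ (t : ℂ)) 1 t := ofRealCLM.hasDerivAt
    have h2 := (hφ t).pow 2
    refine ((((((hq t).pow 3).mul h2).const_mul (-(4 / 5) : ℂ)).sub
      (((ht.mul (hq t)).mul h2).const_mul ((8 / 15) * I))).sub
      (h2.const_mul ((4 / 15) * I))).congr_deriv ?_
    push_cast
    simp only [Pi.pow_apply, Pi.mul_apply]
    ring_nf
    simp only [I_sq]
    ring
  have hF : Integrable (fun t : ℝ ↦ -(4 / 5) * (q t ^ 3 * φ t ^ 2)
      - (8 / 15) * I * (t * q t * φ t ^ 2) - (4 / 15) * I * φ t ^ 2) := by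
    have h1 := (hi 0 3).const_mul (-(4 / 5))
    have h2 := (hi 1 1).const_mul ((8 / 15) * I)
    have h3 := (hi 0 0).const_mul ((4 / 15) * I)
    exact ((h1.sub h2).sub h3).congr (.of_forall fun t ↦ by simp)
  have hA : Integrable (fun t : ℝ ↦ ((I * t + 2 * q t ^ 2) * φ t) ^ 2) := by
    have h1 := (hi 2 0).const_mul (-1)
    have h2 := (hi 1 2).const_mul (4 * I)
    have h3 := (hi 0 4).const_mul 4
    refine ((h1.add h2).add h3).congr (.of_forall fun t ↦ ?_)
    simp only [Pi.add_apply]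
    ring_nf
    simp only [I_sq]
    ring
  have hB : Integrable (fun t : ℝ ↦ 7 / 15 * ((t : ℂ) ^ 2 * φ t ^ 2)) := by
    simpa using (hi 2 0).const_mul (7 / 15)
  have h0 := integral_eq_zero_of_hasDerivAt_of_integrable hd (hA.add hB) hF
  rw [integral_add hA hB, integral_const_mul] at h0
  linear_combination h0

/-- Parseval-type identity `∫ ξ⁴ Ĥ(ξ) Ĥ(-ξ) dξ = (2π)⁻⁴ ∫ (H'')²`. -/
theorem integral_pow_four_mul_fourier (H : 𝓢(ℝ, ℂ)) :
    ∫ x : ℝ, (2 * Real.pi * x : ℂ) ^ 4 * (𝓕 (H : ℝ → ℂ) x * 𝓕 (H : ℝ → ℂ) (-x)) =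
      ∫ t : ℝ, deriv (deriv H) t ^ 2 := by
  set H1 := SchwartzMap.derivCLM ℂ ℂ H with hH1
  set H2 := SchwartzMap.derivCLM ℂ ℂ H1 with hH2
  have e1 : (H1 : ℝ → ℂ) = deriv H := funext fun t ↦ by simp [hH1]
  have e2 : (H2 : ℝ → ℂ) = deriv H1 := funext fun t ↦ by simp [hH2]
  have f1 : 𝓕 (H1 : ℝ → ℂ) = fun x : ℝ ↦ (2 * Real.pi * I * x : ℂ) • 𝓕 (H : ℝ → ℂ) x := by
    rw [e1]
    exact Real.fourier_deriv H.integrable H.differentiable (e1 ▸ H1.integrable)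
  have f2 : 𝓕 (H2 : ℝ → ℂ) = fun x : ℝ ↦ (2 * Real.pi * I * x : ℂ) • 𝓕 (H1 : ℝ → ℂ) x := by
    rw [e2]
    exact Real.fourier_deriv H1.integrable H1.differentiable (e2 ▸ H2.integrable)
  have key := SchwartzMap.integral_fourier_mul_eq H2 (𝓕⁻ H2)
  rw [FourierTransform.fourier_fourierInv_eq] at key
  calc _ = ∫ x, 𝓕 H2 x * 𝓕⁻ H2 x := by
        congr 1
        funext x
        rw [SchwartzMap.fourier_coe, SchwartzMap.fourierInv_coe, Real.fourierInv_eq_fourier_neg,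
          f2, f1]
        simp only [smul_eq_mul]
        push_cast
        ring_nf
        simp only [I_pow_four]
        ring
    _ = ∫ t, H2 t * H2 t := key
    _ = _ := by
        rw [e2, e1]
        simp only [sq]

end LogDeriv

section Airy

theorem airy_zero_eq_ofReal : ∃ a : ℝ, 0 < a ∧
    (3 : ℂ) ^ (-(2 : ℂ) / 3) / Complex.Gamma (2 / 3) = a := by
  refine ⟨(3 : ℝ) ^ (-(2 : ℝ) / 3) / Real.Gamma (2 / 3), ?_, ?_⟩
  · have := Real.Gamma_pos_of_pos (show (0 : ℝ) < 2 / 3 by norm_num)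
    positivity
  · rw [ofReal_div, ofReal_cpow (by norm_num), ← Complex.Gamma_ofReal]
    push_cast
    rfl

theorem airy_deriv_zero_eq_ofReal : ∃ b : ℝ, 0 < b ∧
    -(3 : ℂ) ^ (-(1 : ℂ) / 3) / Complex.Gamma (1 / 3) = -b := by
  refine ⟨(3 : ℝ) ^ (-(1 : ℝ) / 3) / Real.Gamma (1 / 3), ?_, ?_⟩
  · have := Real.Gamma_pos_of_pos (show (0 : ℝ) < 1 / 3 by norm_num)
    positivity
  · rw [ofReal_div, ofReal_cpow (by norm_num), ← Complex.Gamma_ofReal, neg_div]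
    push_cast
    rfl

theorem hasDerivAt_comp_I_mul {F : ℂ → ℂ} (hF : Differentiable ℂ F) (t : ℝ) :
    HasDerivAt (fun s : ℝ ↦ F (I * s)) (I * deriv F (I * t)) t := by
  have h1 : HasDerivAt (fun s : ℝ ↦ I * (s : ℂ)) I t := by
    simpa using (ofRealCLM.hasDerivAt (x := t)).const_mul I
  exact ((hF (I * t)).hasDerivAt.comp t h1).congr_deriv (mul_comm _ _)

/-- `∫ ((1/u)'')² = -(7/15) ∫ t² / u²` for `u'' = -i t u` with suitable initial data, where `1 / u`
is a Schwartz function. -/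
theorem exists_schwartz_inv_and_integral {u v : ℝ → ℂ} (hu : ∀ t, HasDerivAt u (v t) t)
    (hv : ∀ t : ℝ, HasDerivAt v (-(I * t * u t)) t) (h0 : u 0 ≠ 0)
    (hre : (v 0 * conj (u 0)).re = 0) (him : (v 0 * conj (u 0)).im ≤ 0) :
    ∃ H : 𝓢(ℝ, ℂ), (∀ t, H t = (u t)⁻¹) ∧
      ∫ t : ℝ, deriv (deriv H) t ^ 2 = -(7 / 15) * ∫ t : ℝ, (t : ℂ) ^ 2 * ((u t)⁻¹) ^ 2 := by
  obtain ⟨hne, hφd, M, hqM⟩ := inv_rapidDecay_of_hasDerivAt hu hv h0 hre him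
  have hφ : ∀ t, HasDerivAt (fun t ↦ (u t)⁻¹) (-(v t / u t * (u t)⁻¹)) t := fun t ↦
    ((hu t).inv (hne t)).congr_deriv (by have := hne t; field_simp)
  have hq : ∀ t : ℝ, HasDerivAt (fun t ↦ v t / u t) (-(I * t) - (v t / u t) ^ 2) t := fun t ↦
    ((hv t).div (hu t) (hne t)).congr_deriv (by have := hne t; field_simp)
  obtain ⟨H, hH⟩ := exists_schwartz hφ hq hφd hqM
  refine ⟨H, hH, ?_⟩
  rw [← integral_sq_deriv_deriv hφ hq hφd hqM, funext hH, funext fun t ↦ (hφ t).deriv]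
  congr 1
  funext t
  have h : deriv (fun t ↦ -(v t / u t * (u t)⁻¹)) t = _ := ((hq t).mul (hφ t)).neg.deriv
  rw [h]
  ring

end Airy

theorem chernoff_fourth_moment (Ai : ℂ → ℂ)
    (hAi_d1 : Differentiable ℂ Ai)
    (hAi_d2 : Differentiable ℂ (deriv Ai))
    (hAi_ode : ∀ z : ℂ, deriv (deriv Ai) z = z * Ai z)
    (hAi_0 : Ai 0 = (3 : ℂ) ^ (-(2 : ℂ) / 3) / Complex.Gamma (2 / 3))
    (hAi_0' : deriv Ai 0 = -(3 : ℂ) ^ (-(1 : ℂ) / 3) / Complex.Gamma (1 / 3))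
    (hAi_zeros : ∀ z : ℂ, Ai z = 0 → ∃ x : ℝ, x < 0 ∧ z = (x : ℂ))
    (g : ℝ → ℝ)
    (hg : ∀ x : ℝ, (g x : ℂ) =
      (1 / (2 * (Real.pi : ℂ))) *
        ∫ t : ℝ, Complex.exp (-(Complex.I * t * x)) * ((Real.sqrt 2 : ℂ) / Ai (Complex.I * t)))
    (f : ℝ → ℝ)
    (hf : ∀ x : ℝ, f x = (1 / 2) * g x * g (-x)) :
    ((∫ x : ℝ, x ^ 4 * f x : ℝ) : ℂ) =
      (7 / 15) * ((1 / (2 * (Real.pi : ℂ))) *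
        ∫ y : ℝ, (Complex.I * y) ^ 2 / (Ai (Complex.I * y)) ^ 2) := by
  obtain ⟨a, ha, ha'⟩ := airy_zero_eq_ofReal
  obtain ⟨b, hb, hb'⟩ := airy_deriv_zero_eq_ofReal
  rw [ha'] at hAi_0
  rw [hb'] at hAi_0'
  have hu : ∀ t : ℝ, HasDerivAt (fun s : ℝ ↦ Ai (I * s)) (I * deriv Ai (I * t)) t :=
    hasDerivAt_comp_I_mul hAi_d1
  have hv : ∀ t : ℝ, HasDerivAt (fun s : ℝ ↦ I * deriv Ai (I * s)) (-(I * t * Ai (I * t))) t :=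
    fun t ↦ ((hasDerivAt_comp_I_mul hAi_d2 t).const_mul I).congr_deriv (by
      rw [hAi_ode, ← mul_assoc, I_mul_I]; ring)
  obtain ⟨H, hH, hint⟩ := exists_schwartz_inv_and_integral hu hv
    (by simpa [hAi_0] using ha.ne') (by simp [hAi_0, hAi_0'])
    (by simp [hAi_0, hAi_0']; positivity)
  have hpi : (Real.pi : ℂ) ≠ 0 := ofReal_ne_zero.2 Real.pi_ne_zero
  have hsqrt : (Real.sqrt 2 : ℂ) ^ 2 = 2 := by
    rw [← ofReal_pow, Real.sq_sqrt (by norm_num)]; simp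
  have hgF : ∀ x : ℝ, (g x : ℂ) =
      1 / (2 * (Real.pi : ℂ)) * (Real.sqrt 2 * 𝓕 (H : ℝ → ℂ) (x / (2 * Real.pi))) := fun x ↦ by
    rw [hg x, Real.fourier_real_eq_integral_exp_smul, ← integral_const_mul (Real.sqrt 2 : ℂ)]
    congr 2
    funext t
    rw [hH t, smul_eq_mul]
    have : (((-2 * Real.pi * t * (x / (2 * Real.pi)) : ℝ) : ℂ) * I) = -(I * t * x) := by
      push_cast
      field_simp
    rw [this]
    ring
  have hsub := Measure.integral_comp_div
    (fun x : ℝ ↦ (2 * Real.pi * x : ℂ) ^ 4 * (𝓕 (H : ℝ → ℂ) x * 𝓕 (H : ℝ → ℂ) (-x)))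
    (2 * Real.pi)
  rw [integral_pow_four_mul_fourier, hint, abs_of_pos Real.two_pi_pos, real_smul] at hsub
  calc ((∫ x : ℝ, x ^ 4 * f x : ℝ) : ℂ)
      = ∫ x : ℝ, (1 / (2 * (Real.pi : ℂ))) ^ 2 *
          ((2 * Real.pi * (x / (2 * Real.pi) : ℝ) : ℂ) ^ 4 *
          (𝓕 (H : ℝ → ℂ) (x / (2 * Real.pi)) * 𝓕 (H : ℝ → ℂ) (-(x / (2 * Real.pi))))) := by
        rw [← integral_complex_ofReal]
        congr 1
        funext x
        rw [hf]
        push_cast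
        rw [hgF, hgF, neg_div, mul_div_cancel₀ (x : ℂ) (by simp)]
        linear_combination (1 / 2) * (x : ℂ) ^ 4 * (1 / (2 * (Real.pi : ℂ))) ^ 2 *
          𝓕 (H : ℝ → ℂ) (x / (2 * Real.pi)) * 𝓕 (H : ℝ → ℂ) (-(x / (2 * Real.pi))) * hsqrt
    _ = (7 / 15) * ((1 / (2 * (Real.pi : ℂ))) * -∫ t : ℝ, (t : ℂ) ^ 2 * ((Ai (I * t))⁻¹) ^ 2) := by
        rw [integral_const_mul, hsub]
        generalize ∫ t : ℝ, (t : ℂ) ^ 2 * ((Ai (I * t))⁻¹) ^ 2 = J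
        push_cast
        field_simp
    _ = _ := by
        rw [← integral_neg]
        congr 3
        funext t
        rw [mul_pow, I_sq]
        ring
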